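/- arXiv:2407.20953 — 2 statements merged into one kernel-verified Lean document; each statement's English description precedes it below -/
import Mathlib

section
/- For every B ∈ φ(V_D), the family (e_I)_{I ∈ B} is linearly independent over F₂ (hence dim ⟨B⟩ = |B|), and ⟨B⟩ is an isotropic subspace of V_D: (x, y) = 0 for all x, y ∈ ⟨B⟩. -/
open scoped BigOperators

/-- `W D` : functions `Z/(D+1) → F₂`. -/
abbrev Wsp (D : ℕ) : Type := ZMod (D + 1) → ZMod 2

/-- The all-ones function. -/
def allOnes (D : ℕ) : Wsp D := fun _ => 1

/-- `V D = W/span{u}`. -/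
abbrev Vsp (D : ℕ) : Type := Wsp D ⧸ Submodule.span (ZMod 2) {allOnes D}

/-- `e i` : image of the standard basis function at `i`. -/
def eV (D : ℕ) (i : ZMod (D + 1)) : Vsp D :=
  Submodule.Quotient.mk (Pi.single i 1)

/-- `e_I = ∑_{s ∈ I} e_s`. -/
def eSet (D : ℕ) (I : Finset (ZMod (D + 1))) : Vsp D := ∑ s ∈ I, eV D s

/-- A cyclic interval (arc): nonempty proper subset of the form `{i, i+1, …, j}`. -/
def IsInterval (D : ℕ) (I : Finset (ZMod (D + 1))) : Prop :=
  ∃ (i : ZMod (D + 1)) (l : ℕ), 1 ≤ l ∧ l ≤ D ∧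
    I = (Finset.range l).image (fun t : ℕ => i + (t : ZMod (D + 1)))

/-- Member of `ℐ¹` : interval of odd cardinality. -/
def OddInterval (D : ℕ) (I : Finset (ZMod (D + 1))) : Prop :=
  IsInterval D I ∧ Odd I.card

/-- `I ≺ I'` : `I ⊊ I'` and `I' − I` is a disjoint union of two intervals. -/
def Prec (D : ℕ) (I I' : Finset (ZMod (D + 1))) : Prop :=
  I ⊂ I' ∧ ∃ I₁ I₂, IsInterval D I₁ ∧ IsInterval D I₂ ∧ Disjoint I₁ I₂ ∧ I' \ I = I₁ ∪ I₂

/-- `I ♠ I'` : `I ∩ I' = ∅` and `I ∪ I'` is not an interval. -/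
def Spade (D : ℕ) (I I' : Finset (ZMod (D + 1))) : Prop :=
  I ∩ I' = ∅ ∧ ¬ IsInterval D (I ∪ I')

/-- `I^ev`. -/
noncomputable def evSet (D : ℕ) (I : Finset (ZMod (D + 1))) : Finset (ZMod (D + 1)) :=
  @Finset.filter _
    (fun i => ∃ I' I'', OddInterval D I' ∧ OddInterval D I'' ∧ Spade D I' I'' ∧
      I.erase i = I' ∪ I'')
    (Classical.decPred _) I

/-- `B ∈ φ(V_D)` : a finite set of elements of `ℐ¹` satisfying (P0) and (P1). -/
def phi (D : ℕ) (B : Finset (Finset (ZMod (D + 1)))) : Prop :=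
  (∀ I ∈ B, OddInterval D I) ∧
  (∀ I ∈ B, ∀ I' ∈ B, I = I' ∨ Spade D I I' ∨ Prec D I I' ∨ Prec D I' I) ∧
  (∀ I ∈ B, ∃ 𝒥 : Finset (Finset (ZMod (D + 1))), 𝒥 ⊆ B ∧
    (∀ J ∈ 𝒥, Prec D J I) ∧
    (∀ J ∈ 𝒥, ∀ J' ∈ 𝒥, J ≠ J' → Disjoint J J') ∧
    evSet D I ⊆ 𝒥.biUnion id)

/-- `⟨B⟩` : the F₂-span of `{e_I : I ∈ B}`. -/
def spanB (D : ℕ) (B : Finset (Finset (ZMod (D + 1)))) : Submodule (ZMod 2) (Vsp D) :=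
  Submodule.span (ZMod 2) (eSet D '' ↑B)

/-- `g_i(B) = |{I ∈ B : i ∈ I}|`. -/
def gB (D : ℕ) (B : Finset (Finset (ZMod (D + 1)))) (i : ZMod (D + 1)) : ℕ :=
  (B.filter (fun I => i ∈ I)).card

/-- `ε(B) = ∑_i (g_i(B)(g_i(B)+1)/2 mod 2) e_i`. -/
def epsB (D : ℕ) (B : Finset (Finset (ZMod (D + 1)))) : Vsp D :=
  ∑ i : ZMod (D + 1), ((gB D B i * (gB D B i + 1) / 2 : ℕ) : ZMod 2) • eV D i

/-- The partial order `B' ≤ B` on `φ(V_D)`. -/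
def leφ (D : ℕ) (B' B : Finset (Finset (ZMod (D + 1)))) : Prop :=
  ∃ (k : ℕ) (c : ℕ → Finset (Finset (ZMod (D + 1)))),
    c 0 = B' ∧ c k = B ∧ (∀ s ≤ k, phi D (c s)) ∧
    ∀ s < k, epsB D (c s) ∈ spanB D (c (s + 1))

/-- `B' < B`. -/
def ltφ (D : ℕ) (B' B : Finset (Finset (ZMod (D + 1)))) : Prop :=
  leφ D B' B ∧ B' ≠ B

/-- `1_E ∈ ℂ[V_D]`, the indicator function of `E ⊆ V_D`. -/
noncomputable def ind (D : ℕ) (E : Set (Vsp D)) : Vsp D → ℂ := E.indicator 1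

/-- `δ_x ∈ ℂ[V_D]`. -/
noncomputable def delta (D : ℕ) (x : Vsp D) : Vsp D → ℂ := ind D {x}

/-- The symplectic form on `W`. -/
def formW (D : ℕ) (x y : Wsp D) : ZMod 2 :=
  ∑ i : ZMod (D + 1), (x i * y (i + 1) + x (i + 1) * y i)

/-- The induced symplectic form on `V_D` (well defined since the form kills `u`). -/
noncomputable def formV (D : ℕ) (x y : Vsp D) : ZMod 2 :=
  formW D (Quotient.out x) (Quotient.out y)

/-- The Fourier transform `ℂ[V_D] → ℂ[V_D]`. -/
noncomputable def fourierV (D : ℕ) (f : Vsp D → ℂ) : Vsp D → ℂ :=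
  fun y => (2 : ℂ) ^ (-((D / 2 : ℕ) : ℤ)) *
    ∑ᶠ x : Vsp D, (if formV D x y = 0 then (1 : ℂ) else -1) * f x

/-- The target in `V_D` of the basis vector `e'_ℓ` of `V_{D-2}` under `τ_j`. -/
noncomputable def tauTgt (D j : ℕ) (ℓ : ZMod (D - 2 + 1)) : Vsp D :=
  let L : ℕ := if ℓ.val = 0 then D - 1 else ℓ.val
  if ℓ = ((j - 1 : ℕ) : ZMod (D - 2 + 1)) then
    eV D ((j : ZMod (D + 1)) - 1) + eV D (j : ZMod (D + 1)) + eV D ((j : ZMod (D + 1)) + 1)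
  else if L < j - 1 then eV D (L : ZMod (D + 1))
  else eV D ((L + 2 : ℕ) : ZMod (D + 1))

/-- The linear embedding `τ_j : V_{D-2} → V_D` (well defined independently of the chosen
representative since the targets sum to `0`). -/
noncomputable def tauMap (D j : ℕ) (x : Vsp (D - 2)) : Vsp D :=
  ∑ i : ZMod (D - 2 + 1), (Quotient.out x) i • tauTgt D j i

/-- The arc of length `l` starting at `a`. -/
def arc (D : ℕ) (a : ZMod (D + 1)) (l : ℕ) : Finset (ZMod (D + 1)) :=
  (Finset.range l).image (fun t : ℕ => a + (t : ZMod (D + 1)))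

lemma mem_arc {D : ℕ} {a x : ZMod (D + 1)} {l : ℕ} :
    x ∈ arc D a l ↔ ∃ t < l, a + (t : ZMod (D + 1)) = x := by
  simp [arc]

lemma natCast_inj_of_le {D s t : ℕ} (hs : s ≤ D) (ht : t ≤ D)
    (h : (s : ZMod (D + 1)) = t) : s = t := by
  have := congrArg ZMod.val h
  rwa [ZMod.val_natCast_of_lt (by omega), ZMod.val_natCast_of_lt (by omega)] at this

lemma add_natCast_mem_arc {D : ℕ} {a : ZMod (D + 1)} {s l : ℕ} (hs : s ≤ D) (hl : l ≤ D + 1) :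
    a + (s : ZMod (D + 1)) ∈ arc D a l ↔ s < l := by
  rw [mem_arc]
  constructor
  · rintro ⟨t, ht, h⟩
    have := natCast_inj_of_le (by omega) hs (add_left_cancel h)
    omega
  · exact fun h => ⟨s, h, rfl⟩

lemma card_arc {D : ℕ} (a : ZMod (D + 1)) {l : ℕ} (hl : l ≤ D + 1) : (arc D a l).card = l := by
  rw [arc, Finset.card_image_of_injOn, Finset.card_range]
  intro s hs t ht h
  simp only [Finset.coe_range, Set.mem_Iio] at hs ht
  exact natCast_inj_of_le (by omega) (by omega) (add_left_cancel h)

lemma oddInterval_iff {D : ℕ} {I : Finset (ZMod (D + 1))} :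
    OddInterval D I ↔ ∃ a l, Odd l ∧ l ≤ D ∧ I = arc D a l := by
  constructor
  · rintro ⟨⟨a, l, -, h2, rfl⟩, h⟩
    exact ⟨a, l, by rwa [← card_arc a (show l ≤ D + 1 by omega)], h2, rfl⟩
  · rintro ⟨a, l, h, h2, rfl⟩
    exact ⟨⟨a, l, h.pos, h2, rfl⟩, by rwa [card_arc a (by omega)]⟩

lemma start_mem_arc {D : ℕ} {a : ZMod (D + 1)} {l : ℕ} (hl : 0 < l) : a ∈ arc D a l :=
  mem_arc.2 ⟨0, hl, by simp⟩

lemma sub_one_start_notMem_arc {D : ℕ} {a : ZMod (D + 1)} {l : ℕ} (hl : l ≤ D) :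
    a - 1 ∉ arc D a l := by
  have h : a - 1 = a + (D : ZMod (D + 1)) := by
    have : ((D + 1 : ℕ) : ZMod (D + 1)) = 0 := ZMod.natCast_self _
    push_cast at this
    linear_combination -this
  rw [h, add_natCast_mem_arc le_rfl (by omega)]
  omega

/-- The starting point is the only point of an arc whose predecessor may lie outside. -/
lemma eq_start_of_sub_one_notMem {D : ℕ} {a x : ZMod (D + 1)} {l : ℕ}
    (hx : x ∈ arc D a l) (h : x - 1 ∉ arc D a l) : x = a := by
  obtain ⟨t, ht, rfl⟩ := mem_arc.1 hx
  rcases t with _ | t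
  · simp
  · exact absurd (mem_arc.2 ⟨t, by omega, by push_cast; ring⟩) h

lemma eq_end_of_add_one_notMem {D : ℕ} {a x : ZMod (D + 1)} {l : ℕ}
    (hx : x ∈ arc D a l) (h : x + 1 ∉ arc D a l) : x + 1 = a + (l : ZMod (D + 1)) := by
  obtain ⟨t, ht, rfl⟩ := mem_arc.1 hx
  by_cases htl : t + 1 = l
  · subst htl; push_cast; ring
  · exact absurd (mem_arc.2 ⟨t + 1, by omega, by push_cast; ring⟩) h

/-- An arc contained in another one, in coordinates relative to the larger arc. -/
lemma exists_offset_of_subset {D : ℕ} {a b : ZMod (D + 1)} {l m : ℕ} (hl : l ≤ D) (hm : 0 < m)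
    (h : arc D b m ⊆ arc D a l) : ∃ s : ℕ, b = a + (s : ZMod (D + 1)) ∧ s + m ≤ l := by
  obtain ⟨s, hs, rfl⟩ := mem_arc.1 (h (start_mem_arc hm))
  refine ⟨s, rfl, ?_⟩
  by_contra hlt
  have hmem : a + (l : ZMod (D + 1)) ∈ arc D a l :=
    h (mem_arc.2 ⟨l - s, by omega, by rw [Nat.cast_sub hs.le]; ring⟩)
  rw [add_natCast_mem_arc hl (by omega)] at hmem
  omega

lemma Spade.symm {D : ℕ} {I J : Finset (ZMod (D + 1))} (h : Spade D I J) : Spade D J I := by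
  rwa [Spade, Finset.inter_comm, Finset.union_comm]

lemma arc_union_arc {D : ℕ} (a : ZMod (D + 1)) (l m : ℕ) :
    arc D a l ∪ arc D (a + (l : ZMod (D + 1))) m = arc D a (l + m) := by
  ext x
  simp only [Finset.mem_union, mem_arc]
  constructor
  · rintro (⟨t, ht, rfl⟩ | ⟨t, ht, rfl⟩)
    · exact ⟨t, by omega, rfl⟩
    · exact ⟨l + t, by omega, by push_cast; ring⟩
  · rintro ⟨t, ht, rfl⟩
    by_cases h : t < l
    · exact Or.inl ⟨t, h, rfl⟩
    · exact Or.inr ⟨t - l, by omega, by rw [Nat.cast_sub (by omega)]; ring⟩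

lemma Spade.end_notMem {D : ℕ} (hD : Even D) {a : ZMod (D + 1)} {l : ℕ} (hl : Odd l)
    (hlD : l ≤ D) {J : Finset (ZMod (D + 1))} (hJ : OddInterval D J)
    (h : Spade D (arc D a l) J) : a + (l : ZMod (D + 1)) ∉ J := by
  obtain ⟨b, m, hm, hmD, rfl⟩ := oddInterval_iff.1 hJ
  intro hmem
  have hdis : Disjoint (arc D a l) (arc D b m) := Finset.disjoint_iff_inter_eq_empty.2 h.1
  have hend : a + (l : ZMod (D + 1)) - 1 ∈ arc D a l :=
    mem_arc.2 ⟨l - 1, Nat.sub_lt hl.pos one_pos, by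
      rw [Nat.cast_sub (show 1 ≤ l from hl.pos)]; push_cast; ring⟩
  have hb := eq_start_of_sub_one_notMem hmem (Finset.disjoint_left.1 hdis hend)
  have hcard := Finset.card_le_univ (arc D a l ∪ arc D b m)
  rw [Finset.card_union_of_disjoint hdis, card_arc _ (by omega), card_arc _ (by omega),
    ZMod.card] at hcard
  apply h.2
  rw [← hb, arc_union_arc]
  refine ⟨a, l + m, by have := hl.pos; omega, ?_, rfl⟩
  have := hl.add_odd hm
  have : l + m ≠ D + 1 := fun h => by grind
  omega

lemma Spade.start_sub_one_notMem {D : ℕ} (hD : Even D) {a : ZMod (D + 1)} {l : ℕ} (hl : Odd l)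
    (hlD : l ≤ D) {J : Finset (ZMod (D + 1))} (hJ : OddInterval D J)
    (h : Spade D (arc D a l) J) : a - 1 ∉ J := by
  obtain ⟨b, m, hm, hmD, rfl⟩ := oddInterval_iff.1 hJ
  intro hmem
  have hdis : Disjoint (arc D a l) (arc D b m) := Finset.disjoint_iff_inter_eq_empty.2 h.1
  have hb := eq_end_of_add_one_notMem hmem
    (by rw [sub_add_cancel]; exact Finset.disjoint_left.1 hdis (start_mem_arc hl.pos))
  rw [sub_add_cancel] at hb
  apply h.symm.end_notMem hD hm hmD (oddInterval_iff.2 ⟨a, l, hl, hlD, rfl⟩)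
  rw [← hb]
  exact start_mem_arc hl.pos

lemma add_odd_mem_evSet {D : ℕ} {a : ZMod (D + 1)} {l s : ℕ} (hl : Odd l) (hlD : l ≤ D)
    (hs : Odd s) (hsl : s < l) : a + (s : ZMod (D + 1)) ∈ evSet D (arc D a l) := by
  have hs' : s + 1 < l := by
    rcases hs with ⟨k, rfl⟩; rcases hl with ⟨j, rfl⟩; omega
  have herase : (arc D a l).erase (a + (s : ZMod (D + 1))) =
      arc D a s ∪ arc D (a + ((s + 1 : ℕ) : ZMod (D + 1))) (l - (s + 1)) := by
    ext x
    simp only [Finset.mem_erase, Finset.mem_union, mem_arc]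
    constructor
    · rintro ⟨hx, t, ht, rfl⟩
      rcases lt_trichotomy t s with h | rfl | h
      · exact Or.inl ⟨t, h, rfl⟩
      · exact absurd rfl hx
      · exact Or.inr ⟨t - (s + 1), by omega, by rw [Nat.cast_sub (by omega)]; ring⟩
    · rintro (⟨t, ht, rfl⟩ | ⟨t, ht, rfl⟩)
      · refine ⟨fun h => ?_, t, by omega, rfl⟩
        have := natCast_inj_of_le (by omega) (by omega) (add_left_cancel h)
        omega
      · refine ⟨fun h => ?_, s + 1 + t, by omega, by push_cast; ring⟩
        rw [add_assoc, ← Nat.cast_add] at h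
        have := natCast_inj_of_le (by omega) (by omega) (add_left_cancel h)
        omega
  unfold evSet
  refine (@Finset.mem_filter _ _ (Classical.decPred _) _ _).2 ⟨mem_arc.2 ⟨s, hsl, rfl⟩, arc D a s, arc D (a + ((s + 1 : ℕ) : ZMod (D + 1))) (l - (s + 1)),
    oddInterval_iff.2 ⟨a, s, hs, by omega, rfl⟩,
    oddInterval_iff.2 ⟨_, _, by grind, by omega, rfl⟩, ⟨?_, ?_⟩, herase⟩
  · rw [← Finset.disjoint_iff_inter_eq_empty, Finset.disjoint_left]
    rintro x hx hx'
    obtain ⟨t, ht, rfl⟩ := mem_arc.1 hx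
    obtain ⟨r, hr, h⟩ := mem_arc.1 hx'
    rw [add_assoc, ← Nat.cast_add] at h
    have := natCast_inj_of_le (by omega) (by omega) (add_left_cancel h)
    omega
  · rw [← herase]
    rintro ⟨c, n, -, -, h⟩
    change _ = arc D c n at h
    have h1 : a = c := by
      refine eq_start_of_sub_one_notMem (l := n) ?_ ?_
      · rw [← h, herase]
        exact Finset.mem_union_left _ (start_mem_arc hs.pos)
      · rw [← h]
        exact fun h => sub_one_start_notMem_arc hlD (Finset.mem_of_mem_erase h)
    have h2 : a + ((s + 1 : ℕ) : ZMod (D + 1)) = c := by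
      refine eq_start_of_sub_one_notMem (l := n) ?_ ?_
      · rw [← h, herase]
        exact Finset.mem_union_right _ (start_mem_arc (by omega))
      · rw [← h, show a + ((s + 1 : ℕ) : ZMod (D + 1)) - 1 = a + (s : ZMod (D + 1)) by
          push_cast; ring]
        exact Finset.notMem_erase _ _
    rw [← h1] at h2
    have := natCast_inj_of_le (s := s + 1) (t := 0) (D := D) (by omega) (by omega)
      (by simpa using h2)
    omega

/-- Two members of `B` that are not nested are separated. -/
lemma phi.spade_of_not_subset {D : ℕ} {B : Finset (Finset (ZMod (D + 1)))} (hB : phi D B)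
    {I J : Finset (ZMod (D + 1))} (hI : I ∈ B) (hJ : J ∈ B) (h1 : ¬ I ⊆ J) (h2 : ¬ J ⊆ I) :
    Spade D I J := by
  rcases hB.2.1 I hI J hJ with rfl | h | h | h
  · exact absurd subset_rfl h1
  · exact h
  · exact absurd h.1.subset h1
  · exact absurd h.1.subset h2

/-- A member of `B` properly contained in another one avoids both end points of the latter. -/
lemma phi.avoids_ends {D : ℕ} (hD : Even D) {B : Finset (Finset (ZMod (D + 1)))} (hB : phi D B)
    {a : ZMod (D + 1)} {l : ℕ} (hl : Odd l) (hlD : l ≤ D) (hI : arc D a l ∈ B)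
    {K : Finset (ZMod (D + 1))} (hK : K ∈ B) (hKI : K ⊂ arc D a l) :
    ∃ s m : ℕ, K = arc D (a + (s : ZMod (D + 1))) m ∧ 0 < s ∧ s + m < l := by
  obtain ⟨𝒥, h𝒥B, h𝒥I, h𝒥dis, hcov⟩ := hB.2.2 _ hI
  have offset : ∀ K ∈ B, K ⊂ arc D a l → ∃ s m : ℕ, Odd m ∧
      K = arc D (a + (s : ZMod (D + 1))) m ∧ s + m ≤ l ∧ m < l := by
    intro K hK hKI
    obtain ⟨b, m, hm, hmD, rfl⟩ := oddInterval_iff.1 (hB.1 K hK)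
    obtain ⟨s, rfl, hs⟩ := exists_offset_of_subset hlD hm.pos hKI.subset
    refine ⟨s, m, hm, rfl, hs, ?_⟩
    have := Finset.card_lt_card hKI
    rwa [card_arc _ (by omega), card_arc _ (by omega)] at this
  have mem_iff : ∀ s m r : ℕ, s + m ≤ l → r < l →
      (a + (r : ZMod (D + 1)) ∈ arc D (a + (s : ZMod (D + 1))) m ↔ s ≤ r ∧ r < s + m) := by
    intro s m r hsm hr
    rw [mem_arc]
    constructor
    · rintro ⟨t, ht, h⟩
      rw [add_assoc, ← Nat.cast_add] at h
      have := natCast_inj_of_le (by omega) (by omega) (add_left_cancel h)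
      omega
    · rintro ⟨h1, h2⟩
      exact ⟨r - s, by omega, by rw [Nat.cast_sub h1]; ring⟩
  have cover : ∀ r : ℕ, Odd r → r < l → ∃ J ∈ 𝒥, a + (r : ZMod (D + 1)) ∈ J := by
    intro r hr hrl
    simpa using hcov (add_odd_mem_evSet hl hlD hr hrl)
  -- An uncovered neighbour at an odd position lies in a member of `𝒥` containing `K`.
  have swallow : ∀ s m : ℕ, Odd m → arc D (a + (s : ZMod (D + 1))) m ∈ B → s + m ≤ l → m < l →
      Even s → ∃ J ∈ 𝒥, arc D (a + (s : ZMod (D + 1))) m ⊂ J := by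
    intro s m hm hKB hsm hml hs
    have key : ∀ r : ℕ, Odd r → r < l → r + 1 = s ∨ r = s + m →
        ∃ J ∈ 𝒥, arc D (a + (s : ZMod (D + 1))) m ⊂ J := by
      intro r hr hrl hrs
      obtain ⟨J, hJ, hrJ⟩ := cover r hr hrl
      have hrK : a + (r : ZMod (D + 1)) ∉ arc D (a + (s : ZMod (D + 1))) m := by
        rw [mem_iff s m r hsm hrl]; omega
      have hJK : ¬ J ⊆ arc D (a + (s : ZMod (D + 1))) m := fun h => hrK (h hrJ)
      refine ⟨J, hJ, ?_, hJK⟩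
      by_contra hKJ
      have hsp := hB.spade_of_not_subset hKB (h𝒥B hJ) hKJ hJK
      rcases hrs with rfl | rfl
      · apply hsp.start_sub_one_notMem hD hm (by omega) (hB.1 _ (h𝒥B hJ))
        rwa [show a + ((r + 1 : ℕ) : ZMod (D + 1)) - 1 = a + (r : ZMod (D + 1)) by
          push_cast; ring]
      · apply hsp.end_notMem hD hm (by omega) (hB.1 _ (h𝒥B hJ))
        rwa [add_assoc, ← Nat.cast_add]
    by_cases h : s + m < l
    · exact key (s + m) (hs.add_odd hm) h (Or.inr rfl)
    · exact key (s - 1) (by grind) (by omega) (Or.inl (by omega))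
  have odd_offset : ∀ s m : ℕ, Odd m → arc D (a + (s : ZMod (D + 1))) m ∈ 𝒥 → s + m ≤ l → m < l →
      Odd s := by
    intro s m hm hJ hsm hml
    by_contra hs
    rw [Nat.not_odd_iff_even] at hs
    obtain ⟨J, hJ', hlt⟩ := swallow s m hm (h𝒥B hJ) hsm hml hs
    have hmem := start_mem_arc (a := a + (s : ZMod (D + 1))) hm.pos
    exact Finset.disjoint_left.1 (h𝒥dis _ hJ _ hJ' hlt.ne) hmem (hlt.subset hmem)
  obtain ⟨s, m, hm, rfl, hsm, hml⟩ := offset K hK hKI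
  refine ⟨s, m, rfl, ?_⟩
  by_contra hcon
  have hs : Even s := by grind
  obtain ⟨J, hJ, hlt⟩ := swallow s m hm hK hsm hml hs
  obtain ⟨s', m', hm', rfl, hsm', hml'⟩ := offset J (h𝒥B hJ) (h𝒥I J hJ).1
  have hs' := odd_offset s' m' hm' hJ hsm' hml'
  have hpos := hm.pos
  have hfirst := (mem_iff s' m' s hsm' (by omega)).1
    (hlt.subset ((mem_iff s m s hsm (by omega)).2 (by omega)))
  have hlast := (mem_iff s' m' (s + m - 1) hsm' (by omega)).1
    (hlt.subset ((mem_iff s m (s + m - 1) hsm (by omega)).2 (by omega)))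
  grind

lemma phi.start_and_end_notMem {D : ℕ} (hD : Even D) {B : Finset (Finset (ZMod (D + 1)))}
    (hB : phi D B) {a : ZMod (D + 1)} {l : ℕ} (hl : Odd l) (hlD : l ≤ D) (hI : arc D a l ∈ B)
    {K : Finset (ZMod (D + 1))} (hK : K ∈ B) (hKI : K ⊂ arc D a l) :
    a ∉ K ∧ a + (l : ZMod (D + 1)) - 1 ∉ K := by
  obtain ⟨s, m, rfl, hs, hsm⟩ := hB.avoids_ends hD hl hlD hI hK hKI
  constructor
  · intro h
    obtain ⟨t, ht, h⟩ := mem_arc.1 h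
    have := natCast_inj_of_le (s := s + t) (t := 0) (D := D) (by omega) (by omega)
      (by rw [add_assoc] at h; simpa using h)
    omega
  · intro h
    obtain ⟨t, ht, h⟩ := mem_arc.1 h
    have := natCast_inj_of_le (s := s + t + 1) (t := l) (D := D) (by omega) (by omega)
      (by push_cast; linear_combination h)
    omega

/-- The indicator function of `I` as an element of `W`. -/
def indW (D : ℕ) (I : Finset (ZMod (D + 1))) : Wsp D := fun i => if i ∈ I then 1 else 0

lemma eSet_eq_mk (D : ℕ) (I : Finset (ZMod (D + 1))) :
    eSet D I = Submodule.Quotient.mk (indW D I) := by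
  have h : indW D I = ∑ s ∈ I, Pi.single s 1 := by
    ext i
    simp [indW, Finset.sum_apply, Pi.single_apply]
  rw [h]
  simp only [eSet, eV, ← Submodule.mkQ_apply, map_sum]

/-- The linear form `x ↦ x_a + x_{a-1}` on `V`. -/
noncomputable def jump (D : ℕ) (a : ZMod (D + 1)) : Vsp D →ₗ[ZMod 2] ZMod 2 :=
  Submodule.liftQ _
    { toFun := fun x : Wsp D => x a + x (a - 1)
      map_add' := fun x y => by simp only [Pi.add_apply]; ring
      map_smul' := fun c x => by simp [mul_add] } (by
    rw [Submodule.span_singleton_le_iff_mem, LinearMap.mem_ker]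
    exact CharTwo.add_self_eq_zero (1 : ZMod 2))

lemma jump_eSet (D : ℕ) (a : ZMod (D + 1)) (I : Finset (ZMod (D + 1))) :
    jump D a (eSet D I) = (if a ∈ I then 1 else 0) + (if a - 1 ∈ I then 1 else 0) := by
  rw [eSet_eq_mk, jump, Submodule.liftQ_apply]
  rfl

/-- The jump at the starting point of `I` separates `e_I` from the other members of `B`. -/
lemma phi.jump_start {D : ℕ} (hD : Even D) {B : Finset (Finset (ZMod (D + 1)))} (hB : phi D B)
    {a : ZMod (D + 1)} {l : ℕ} (hl : Odd l) (hlD : l ≤ D) (hI : arc D a l ∈ B)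
    {K : Finset (ZMod (D + 1))} (hK : K ∈ B) :
    jump D a (eSet D K) = if K = arc D a l then 1 else 0 := by
  have ha : a ∈ arc D a l := start_mem_arc hl.pos
  have ha' : a - 1 ∉ arc D a l := sub_one_start_notMem_arc hlD
  rw [jump_eSet]
  rcases hB.2.1 _ hI K hK with rfl | h | h | h
  · simp [ha, ha']
  · have h1 : a ∉ K := Finset.disjoint_left.1 (Finset.disjoint_iff_inter_eq_empty.2 h.1) ha
    have h2 := h.start_sub_one_notMem hD hl hlD (hB.1 K hK)
    have h3 : K ≠ arc D a l := fun h => h1 (h ▸ ha)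
    simp [h1, h2, h3]
  · have h1 : a ∈ K := h.1.subset ha
    obtain ⟨b, m, hm, hmD, rfl⟩ := oddInterval_iff.1 (hB.1 K hK)
    have h2 : a - 1 ∈ arc D b m := by
      by_contra h2
      have hab := eq_start_of_sub_one_notMem h1 h2
      exact (hB.start_and_end_notMem hD hm hmD hK hI h.1).1 (hab ▸ ha)
    simp only [h1, h2, h.1.ne', if_true, if_false]
    decide
  · have h1 := (hB.start_and_end_notMem hD hl hlD hI hK h.1).1
    have h2 : a - 1 ∉ K := fun h' => ha' (h.1.subset h')
    simp [h1, h2, h.1.ne]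

lemma phi.linearIndependent {D : ℕ} (hD : Even D) {B : Finset (Finset (ZMod (D + 1)))}
    (hB : phi D B) :
    LinearIndependent (ZMod 2) (fun I : B => eSet D (I : Finset (ZMod (D + 1)))) := by
  rw [Fintype.linearIndependent_iff]
  rintro g hg ⟨I, hI⟩
  obtain ⟨a, l, hl, hlD, rfl⟩ := oddInterval_iff.1 (hB.1 I hI)
  have h := congrArg (jump D a) hg
  rw [map_sum, map_zero, Finset.sum_eq_single ⟨arc D a l, hI⟩] at h
  · simpa [hB.jump_start hD hl hlD hI hI] using h
  · rintro ⟨K, hK⟩ - hne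
    have hne' : K ≠ arc D a l := fun h => hne (Subtype.ext h)
    simp [hB.jump_start hD hl hlD hI hK, hne']
  · simp

lemma formW_add_left (D : ℕ) (x y z : Wsp D) :
    formW D (x + y) z = formW D x z + formW D y z := by
  simp only [formW, Pi.add_apply, ← Finset.sum_add_distrib]
  exact Finset.sum_congr rfl fun i _ => by ring

lemma formW_comm (D : ℕ) (x y : Wsp D) : formW D x y = formW D y x :=
  Finset.sum_congr rfl fun i _ => by ring

lemma formW_smul_left (D : ℕ) (c : ZMod 2) (x y : Wsp D) :
    formW D (c • x) y = c * formW D x y := by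
  simp only [formW, Pi.smul_apply, smul_eq_mul, Finset.mul_sum]
  exact Finset.sum_congr rfl fun i _ => by ring

lemma formW_eq_sum_mul (D : ℕ) (x y : Wsp D) :
    formW D x y = ∑ i, x i * (y (i + 1) + y (i - 1)) := by
  simp only [formW, mul_add, Finset.sum_add_distrib]
  congr 1
  exact Fintype.sum_equiv (Equiv.addRight 1) _ _ fun i => by simp

lemma formW_of_mem_span_left {D : ℕ} {x : Wsp D}
    (hx : x ∈ Submodule.span (ZMod 2) {allOnes D}) (y : Wsp D) : formW D x y = 0 := by
  obtain ⟨c, rfl⟩ := Submodule.mem_span_singleton.1 hx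
  rw [formW_smul_left, formW_comm, formW_eq_sum_mul, Finset.sum_eq_zero, mul_zero]
  intro i _
  rw [show allOnes D (i + 1) + allOnes D (i - 1) = 0 from by change (1 + 1 : ZMod 2) = 0; decide,
    mul_zero]

lemma formW_congr_left {D : ℕ} {x x' : Wsp D}
    (h : (Submodule.Quotient.mk x : Vsp D) = Submodule.Quotient.mk x') (y : Wsp D) :
    formW D x y = formW D x' y := by
  rw [← sub_add_cancel x x', formW_add_left,
    formW_of_mem_span_left ((Submodule.Quotient.eq _).1 h), zero_add]

lemma formV_mk (D : ℕ) (x y : Wsp D) :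
    formV D (Submodule.Quotient.mk x) (Submodule.Quotient.mk y) = formW D x y := by
  have hout : ∀ z : Wsp D, (Submodule.Quotient.mk
      (Quotient.out (Submodule.Quotient.mk z : Vsp D)) : Vsp D) = Submodule.Quotient.mk z :=
    fun z => Quotient.out_eq _
  rw [formV, formW_congr_left (hout x), formW_comm, formW_congr_left (hout y), formW_comm]

lemma formV_comm (D : ℕ) (x y : Vsp D) : formV D x y = formV D y x := formW_comm D _ _

lemma formV_add_left (D : ℕ) (x y z : Vsp D) :
    formV D (x + y) z = formV D x z + formV D y z := by
  obtain ⟨x, rfl⟩ := Submodule.Quotient.mk_surjective _ x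
  obtain ⟨y, rfl⟩ := Submodule.Quotient.mk_surjective _ y
  obtain ⟨z, rfl⟩ := Submodule.Quotient.mk_surjective _ z
  rw [← Submodule.Quotient.mk_add]
  simp only [formV_mk, formW_add_left]

lemma formV_smul_left (D : ℕ) (c : ZMod 2) (x y : Vsp D) :
    formV D (c • x) y = c * formV D x y := by
  obtain ⟨x, rfl⟩ := Submodule.Quotient.mk_surjective _ x
  obtain ⟨y, rfl⟩ := Submodule.Quotient.mk_surjective _ y
  rw [← Submodule.Quotient.mk_smul]
  simp only [formV_mk, formW_smul_left]

lemma formV_eq_zero_of_mem_span {D : ℕ} {S : Set (Vsp D)} {x y : Vsp D}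
    (h : ∀ z ∈ S, formV D z y = 0) (hx : x ∈ Submodule.span (ZMod 2) S) : formV D x y = 0 := by
  induction hx using Submodule.span_induction with
  | mem z hz => exact h z hz
  | zero => simpa using formV_smul_left D 0 0 y
  | add x z _ _ hx hz => rw [formV_add_left, hx, hz, add_zero]
  | smul c x _ hx => rw [formV_smul_left, hx, mul_zero]

lemma formV_eSet_eq_zero {D : ℕ} {K I : Finset (ZMod (D + 1))}
    (h : ∀ i ∈ K, (i + 1 ∈ I ↔ i - 1 ∈ I)) : formV D (eSet D K) (eSet D I) = 0 := by
  rw [eSet_eq_mk, eSet_eq_mk, formV_mk, formW_eq_sum_mul]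
  refine Finset.sum_eq_zero fun i _ => ?_
  by_cases hi : i ∈ K
  · simp only [indW, hi, if_true, h i hi, one_mul]
    exact CharTwo.add_self_eq_zero _
  · simp [indW, hi]

lemma phi.formV_eq_zero_of_ssubset {D : ℕ} (hD : Even D) {B : Finset (Finset (ZMod (D + 1)))}
    (hB : phi D B) {I K : Finset (ZMod (D + 1))} (hI : I ∈ B) (hK : K ∈ B) (hKI : K ⊂ I) :
    formV D (eSet D K) (eSet D I) = 0 := by
  obtain ⟨a, l, hl, hlD, rfl⟩ := oddInterval_iff.1 (hB.1 I hI)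
  obtain ⟨h1, h2⟩ := hB.start_and_end_notMem hD hl hlD hI hK hKI
  refine formV_eSet_eq_zero fun i hi => iff_of_true ?_ ?_ <;> by_contra hcon
  · have := eq_end_of_add_one_notMem (hKI.subset hi) hcon
    exact h2 (by rwa [← this, add_sub_cancel_right])
  · exact h1 (eq_start_of_sub_one_notMem (hKI.subset hi) hcon ▸ hi)

lemma Spade.formV_eq_zero {D : ℕ} (hD : Even D) {I K : Finset (ZMod (D + 1))}
    (hI : OddInterval D I) (hK : OddInterval D K) (h : Spade D I K) :
    formV D (eSet D K) (eSet D I) = 0 := by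
  obtain ⟨a, l, hl, hlD, rfl⟩ := oddInterval_iff.1 hI
  have hdis := Finset.disjoint_iff_inter_eq_empty.2 h.1
  refine formV_eSet_eq_zero fun i hi => iff_of_false (fun hcon => ?_) (fun hcon => ?_) <;>
    have hi' := Finset.disjoint_right.1 hdis hi
  · have := eq_start_of_sub_one_notMem hcon (by rwa [add_sub_cancel_right])
    exact h.start_sub_one_notMem hD hl hlD hK (by rwa [← this, add_sub_cancel_right])
  · have := eq_end_of_add_one_notMem hcon (by rwa [sub_add_cancel])
    exact h.end_notMem hD hl hlD hK (by rwa [← this, sub_add_cancel])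

lemma phi.formV_eSet_eq_zero {D : ℕ} (hD : Even D) {B : Finset (Finset (ZMod (D + 1)))}
    (hB : phi D B) {I K : Finset (ZMod (D + 1))} (hI : I ∈ B) (hK : K ∈ B) :
    formV D (eSet D K) (eSet D I) = 0 := by
  rcases hB.2.1 I hI K hK with rfl | h | h | h
  · rw [eSet_eq_mk, formV_mk, formW]
    exact Finset.sum_eq_zero fun i _ => by rw [mul_comm]; exact CharTwo.add_self_eq_zero _
  · exact h.formV_eq_zero hD (hB.1 I hI) (hB.1 K hK)
  · rw [formV_comm]
    exact hB.formV_eq_zero_of_ssubset hD hK hI h.1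
  · exact hB.formV_eq_zero_of_ssubset hD hI hK h.1

/-- For `B ∈ φ(V_D)`, the family `(e_I)_{I ∈ B}` is linearly independent over `F₂`
(hence `dim ⟨B⟩ = |B|`), and `⟨B⟩` is isotropic. -/
theorem eI_linearIndependent_isotropic (D : ℕ) (hD : 2 ≤ D) (hDev : Even D)
    (B : Finset (Finset (ZMod (D + 1)))) (hB : phi D B) :
    LinearIndependent (ZMod 2) (fun I : B => eSet D (I : Finset (ZMod (D + 1)))) ∧
    Module.finrank (ZMod 2) (spanB D B) = B.card ∧
    ∀ x ∈ spanB D B, ∀ y ∈ spanB D B, formV D x y = 0 := by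
  have hli := hB.linearIndependent hDev
  refine ⟨hli, ?_, fun x hx y hy => ?_⟩
  · have h := finrank_span_eq_card hli
    rw [Fintype.card_coe, show (Set.range fun I : B => eSet D (I : Finset (ZMod (D + 1)))) =
      eSet D '' ↑B by ext; simp] at h
    exact h
  · refine formV_eq_zero_of_mem_span ?_ hx
    rintro _ ⟨K, hK, rfl⟩
    rw [formV_comm]
    refine formV_eq_zero_of_mem_span ?_ hy
    rintro _ ⟨I, hI, rfl⟩
    exact hB.formV_eSet_eq_zero hDev hK hI
end

section
/- Lemma 1.3(a), first case: Let B ∈ φ(V_D) and i ∈ Z/(D+1) with {i} ∈ B, and suppose g_i(B) = 1 (that is, {i} is the only element of B containing i). Then B − {{i}} ∈ φ(V_D). -/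
open scoped BigOperators

/-- Lemma 1.3(a), first case: if `{i} ∈ B` and `g_i(B) = 1` then `B − {{i}} ∈ φ(V_D)`. -/
theorem lemma_1_3_a_case1 (D : ℕ) (hD : 2 ≤ D) (hDev : Even D)
    (B : Finset (Finset (ZMod (D + 1)))) (hB : phi D B) (i : ZMod (D + 1))
    (hi : {i} ∈ B) (hg : gB D B i = 1) :
    phi D (B.erase {i}) := by
  obtain ⟨hodd, hP0, hP1⟩ := hB
  have huniq : ∀ I ∈ B, i ∈ I → I = {i} := fun I hI hiI =>
    Finset.card_le_one.mp hg.le I (Finset.mem_filter.mpr ⟨hI, hiI⟩) {i}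
      (Finset.mem_filter.mpr ⟨hi, Finset.mem_singleton_self i⟩)
  refine ⟨fun I hI => hodd I (Finset.mem_of_mem_erase hI),
    fun I hI I' hI' => hP0 I (Finset.mem_of_mem_erase hI) I' (Finset.mem_of_mem_erase hI'),
    fun I hI => ?_⟩
  obtain ⟨hne, hIB⟩ := Finset.mem_erase.mp hI
  obtain ⟨𝒥, hJB, hprec, hdisj, hcover⟩ := hP1 I hIB
  refine ⟨𝒥, fun J hJ => Finset.mem_erase.mpr ⟨?_, hJB hJ⟩, hprec, hdisj, hcover⟩
  rintro rfl
  exact hne (huniq I hIB ((hprec _ hJ).1.subset (Finset.mem_singleton_self i)))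
end
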